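/- arXiv:1910.03356 — 4 statements merged into one kernel-verified Lean document; each statement's English description precedes it below -/
import Mathlib

section
/- Let q ∈ ℂ be nonzero and not a root of unity, let ℓ² be the Hilbert space of square-summable complex sequences indexed by ℕ, and let B(ℓ²) be the unital ℂ-algebra of bounded (continuous) linear operators on ℓ². Suppose a, a⁺ ∈ B(ℓ²) satisfy a·a⁺ − q·a⁺·a = 1 and (a·a⁺ − a⁺·a)^n ≠ 0 for every n ∈ ℕ. Then the unique unital ℂ-algebra homomorphism Ψ : H(q) → B(ℓ²) with Ψ(A) = a and Ψ(B) = a⁺ is injective; consequently the unital subalgebra of B(ℓ²) generated by a and a⁺ is isomorphic to H(q). -/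
noncomputable section

/-- Generators of the `q`-deformed Heisenberg algebra. -/
inductive HGen : Type
  | A : HGen
  | B : HGen

/-- The defining relation `AB = q • BA + 1` of the `q`-deformed Heisenberg algebra. -/
inductive HRel (q : ℂ) : FreeAlgebra ℂ HGen → FreeAlgebra ℂ HGen → Prop
  | rel : HRel q (FreeAlgebra.ι ℂ HGen.A * FreeAlgebra.ι ℂ HGen.B)
      (q • (FreeAlgebra.ι ℂ HGen.B * FreeAlgebra.ι ℂ HGen.A) + 1)

/-- The `q`-deformed Heisenberg algebra `H(q)`, presented by generators `A`, `B`
and the single relation `AB - q • BA = 1`. -/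
abbrev HAlg (q : ℂ) := RingQuot (HRel q)

/-- The generator `A` of `H(q)`. -/
def genA (q : ℂ) : HAlg q := RingQuot.mkAlgHom ℂ (HRel q) (FreeAlgebra.ι ℂ HGen.A)

/-- The generator `B` of `H(q)`. -/
def genB (q : ℂ) : HAlg q := RingQuot.mkAlgHom ℂ (HRel q) (FreeAlgebra.ι ℂ HGen.B)

/-- The element `C = AB - BA` of `H(q)`. -/
def genC (q : ℂ) : HAlg q := genA q * genB q - genB q * genA q

/-- `ℓ²`, the Hilbert space of square-summable complex sequences indexed by `ℕ`. -/
abbrev EllTwo : Type := lp (fun _ : ℕ => ℂ) 2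

/-- `B(ℓ²)`, the unital `ℂ`-algebra of bounded linear operators on `ℓ²`. -/
abbrev BoundedOps : Type := EllTwo →L[ℂ] EllTwo

namespace QHeisenberg

open Polynomial

section General

variable {K R : Type*} [Field K] [Ring R] [Algebra K R]

/-- The monomials `a ^ n` for `n ≥ 0` and `b ^ (-n)` for `n < 0`. -/
def monomialZ (a b : R) : ℤ → R
  | Int.ofNat n => a ^ n
  | Int.negSucc n => b ^ (n + 1)

lemma mul_aeval_of_mul_eq {x c d : R} (h : x * c = d * x) (p : K[X]) :
    x * aeval c p = aeval d p * x := by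
  induction p using Polynomial.induction_on' with
  | add p r hp hr => rw [map_add, map_add, mul_add, add_mul, hp, hr]
  | monomial n k =>
    have hn : x * c ^ n = d ^ n * x := (SemiconjBy.pow_right (show SemiconjBy x c d from h) n)
    rw [aeval_monomial, aeval_monomial, ← mul_assoc, ← Algebra.commutes, mul_assoc, hn, mul_assoc]

lemma aeval_smul_eq_comp (k : K) (c : R) (p : K[X]) :
    aeval (k • c) p = aeval c (p.comp (C k * X)) := by
  rw [aeval_comp, map_mul, aeval_C, aeval_X, Algebra.smul_def]

lemma comp_C_mul_X_ne_zero {k : K} (hk : k ≠ 0) {p : K[X]} (hp : p ≠ 0) :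
    p.comp (C k * X) ≠ 0 := by
  intro h
  rcases comp_eq_zero_iff.mp h with h | ⟨-, h⟩
  · exact hp h
  · have := congrArg (fun r : K[X] => r.coeff 1) h
    simp [coeff_C] at this
    exact hk this

/-- The linear map sending a finitely supported family `p` of polynomials to
`∑ n, p n (ab - ba) * monomialZ a b n`. -/
def normalForm (K : Type*) [Field K] [Algebra K R] (a b : R) : (ℤ →₀ K[X]) →ₗ[K] R :=
  Finsupp.lsum K fun n =>
    LinearMap.mulRight K (monomialZ a b n) ∘ₗ (aeval (R := K) (a * b - b * a)).toLinearMap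

lemma normalForm_apply (a b : R) (f : ℤ →₀ K[X]) :
    normalForm K a b f = f.sum fun n p => aeval (a * b - b * a) p * monomialZ a b n := rfl

lemma normalForm_single (a b : R) (n : ℤ) (p : K[X]) :
    normalForm K a b (Finsupp.single n p) = aeval (a * b - b * a) p * monomialZ a b n := by
  rw [normalForm_apply, Finsupp.sum_single_index (by simp)]

lemma map_normalForm {S : Type*} [Ring S] [Algebra K S] (φ : R →ₐ[K] S) (a b : R)
    (f : ℤ →₀ K[X]) : φ (normalForm K a b f) = normalForm K (φ a) (φ b) f := by
  have hm (n : ℤ) : φ (monomialZ a b n) = monomialZ (φ a) (φ b) n := by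
    cases n <;> simp [monomialZ]
  simp [normalForm_apply, Finsupp.sum, hm, ← aeval_algHom_apply]

variable {q : K} {a b : R}

section Relations

variable (hrel : a * b - q • (b * a) = 1)
include hrel

lemma mul_eq : a * b = q • (b * a) + 1 := by
  rw [← hrel]; abel

lemma commutator_eq : a * b - b * a = (q - 1) • (b * a) + 1 := by
  rw [mul_eq hrel, sub_smul, one_smul]; abel

lemma left_mul_commutator : a * (a * b - b * a) = (q • (a * b - b * a)) * a := by
  have h1 : a * (b * a) = q • (b * a * a) + a := by
    rw [← mul_assoc, mul_eq hrel, add_mul, smul_mul_assoc, one_mul]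
  rw [commutator_eq hrel, mul_add, mul_smul_comm, h1, smul_mul_assoc, add_mul, smul_mul_assoc]
  simp only [one_mul, mul_one]
  module

lemma right_mul_commutator (hq : q ≠ 0) :
    b * (a * b - b * a) = (q⁻¹ • (a * b - b * a)) * b := by
  have h1 : b * a * b = q • (b * (b * a)) + b := by
    rw [mul_assoc, mul_eq hrel, mul_add, mul_smul_comm, mul_one]
  have h2 : (a * b - b * a) * b = q • (b * (a * b - b * a)) := by
    rw [commutator_eq hrel, add_mul, smul_mul_assoc, h1, mul_add, mul_smul_comm]
    simp only [one_mul, mul_one]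
    module
  rw [smul_mul_assoc, h2, smul_smul, inv_mul_cancel₀ hq, one_smul]

lemma right_mul_left_eq_aeval (hq1 : q ≠ 1) :
    b * a = aeval (a * b - b * a) (C (q - 1)⁻¹ * (X - C 1)) := by
  have hq1' : q - 1 ≠ 0 := sub_ne_zero.mpr hq1
  simp only [map_mul, aeval_C, map_sub, aeval_X, map_one]
  rw [← Algebra.smul_def, commutator_eq hrel, add_sub_cancel_right, smul_smul,
    inv_mul_cancel₀ hq1', one_smul]

lemma left_mul_right_eq_aeval (hq1 : q ≠ 1) :
    a * b = aeval (a * b - b * a) (C (q - 1)⁻¹ * (C q * X - C 1)) := by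
  have hq1' : q - 1 ≠ 0 := sub_ne_zero.mpr hq1
  simp only [map_mul, aeval_C, map_sub, aeval_X, map_one]
  rw [← Algebra.smul_def, ← Algebra.smul_def, commutator_eq hrel, mul_eq hrel]
  have : q • ((q - 1) • (b * a) + 1) - 1 = (q - 1) • (q • (b * a) + (1 : R)) := by module
  rw [this, smul_smul, inv_mul_cancel₀ hq1', one_smul]

lemma exists_left_mul_monomialZ (hq0 : q ≠ 0) (hq1 : q ≠ 1) (n : ℤ) :
    ∃ u : K[X], u ≠ 0 ∧
      a * monomialZ a b n = aeval (a * b - b * a) u * monomialZ a b (n + 1) := by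
  rcases n with n | n
  · exact ⟨1, one_ne_zero, by rw [map_one, one_mul]; exact (pow_succ' a n).symm⟩
  · refine ⟨C (q - 1)⁻¹ * (C q * X - C 1), ?_, ?_⟩
    · refine mul_ne_zero (C_ne_zero.mpr (inv_ne_zero (sub_ne_zero.mpr hq1))) fun h => hq0 ?_
      simpa [coeff_C, coeff_one] using congrArg (fun r : K[X] => r.coeff 1) h
    · have h : monomialZ a b (Int.negSucc n + 1) = b ^ n := by
        cases n with
        | zero => simp [monomialZ]
        | succ n => rfl
      rw [h, ← left_mul_right_eq_aeval hrel hq1, mul_assoc, ← pow_succ']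
      rfl

lemma exists_right_mul_monomialZ (hq1 : q ≠ 1) (n : ℤ) :
    ∃ v : K[X], v ≠ 0 ∧
      b * monomialZ a b n = aeval (a * b - b * a) v * monomialZ a b (n - 1) := by
  rcases n with (_ | n) | n
  · exact ⟨1, one_ne_zero, by
      rw [map_one, one_mul, show Int.ofNat 0 - 1 = Int.negSucc 0 from rfl]
      simp [monomialZ]⟩
  · refine ⟨C (q - 1)⁻¹ * (X - C 1), ?_, ?_⟩
    · exact mul_ne_zero (C_ne_zero.mpr (inv_ne_zero (sub_ne_zero.mpr hq1))) (X_sub_C_ne_zero 1)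
    · have h : Int.ofNat (n + 1) - 1 = Int.ofNat n := by simp
      rw [h, ← right_mul_left_eq_aeval hrel hq1, mul_assoc]
      exact congrArg (b * ·) (pow_succ' a n)
  · exact ⟨1, one_ne_zero, by rw [map_one, one_mul]; exact (pow_succ' b (n + 1)).symm⟩

lemma exists_left_mul_aeval_mul_monomialZ (hq0 : q ≠ 0) (hq1 : q ≠ 1) (n : ℤ) (p : K[X]) :
    ∃ r : K[X], (p ≠ 0 → r ≠ 0) ∧ a * (aeval (a * b - b * a) p * monomialZ a b n) =
      aeval (a * b - b * a) r * monomialZ a b (n + 1) := by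
  obtain ⟨u, hu, h⟩ := exists_left_mul_monomialZ hrel hq0 hq1 n
  refine ⟨p.comp (C q * X) * u, fun hp => mul_ne_zero (comp_C_mul_X_ne_zero hq0 hp) hu, ?_⟩
  rw [← mul_assoc, mul_aeval_of_mul_eq (left_mul_commutator hrel), mul_assoc, h, map_mul,
    mul_assoc, aeval_smul_eq_comp]

lemma exists_right_mul_aeval_mul_monomialZ (hq0 : q ≠ 0) (hq1 : q ≠ 1) (n : ℤ) (p : K[X]) :
    ∃ r : K[X], (p ≠ 0 → r ≠ 0) ∧ b * (aeval (a * b - b * a) p * monomialZ a b n) =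
      aeval (a * b - b * a) r * monomialZ a b (n - 1) := by
  obtain ⟨v, hv, h⟩ := exists_right_mul_monomialZ hrel hq1 n
  refine ⟨p.comp (C q⁻¹ * X) * v,
    fun hp => mul_ne_zero (comp_C_mul_X_ne_zero (inv_ne_zero hq0) hp) hv, ?_⟩
  rw [← mul_assoc, mul_aeval_of_mul_eq (right_mul_commutator hrel hq0), mul_assoc, h, map_mul,
    mul_assoc, aeval_smul_eq_comp]

/-- Every element of the subalgebra generated by `a` and `b` has a normal form. -/
lemma mem_range_normalForm (hq0 : q ≠ 0) (hq1 : q ≠ 1) {x : R}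
    (hx : x ∈ Algebra.adjoin K ({a, b} : Set R)) :
    x ∈ LinearMap.range (normalForm K a b) := by
  have key : ∀ y ∈ LinearMap.range (normalForm K a b),
      x * y ∈ LinearMap.range (normalForm K a b) := by
    induction hx using Algebra.adjoin_induction with
    | mem x hx =>
      rintro _ ⟨f, rfl⟩
      induction f using Finsupp.induction_linear with
      | zero => simp
      | add f g hf hg =>
        rw [map_add, mul_add]
        exact add_mem hf hg
      | single n p =>
        rw [normalForm_single]
        rcases hx with rfl | rfl
        · obtain ⟨r, -, h⟩ := exists_left_mul_aeval_mul_monomialZ hrel hq0 hq1 n p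
          exact ⟨Finsupp.single (n + 1) r, by rw [normalForm_single, h]⟩
        · obtain ⟨r, -, h⟩ := exists_right_mul_aeval_mul_monomialZ hrel hq0 hq1 n p
          exact ⟨Finsupp.single (n - 1) r, by rw [normalForm_single, h]⟩
    | algebraMap k =>
      intro y hy
      rw [← Algebra.smul_def]
      exact Submodule.smul_mem _ k hy
    | add x y _ _ hx hy =>
      intro z hz
      rw [add_mul]
      exact add_mem (hx z hz) (hy z hz)
    | mul x y _ _ hx hy =>
      intro z hz
      rw [mul_assoc]
      exact hx _ (hy z hz)
  have h1 : (1 : R) ∈ LinearMap.range (normalForm K a b) :=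
    ⟨Finsupp.single 0 1, by simp [normalForm_single, monomialZ]⟩
  simpa using key 1 h1

lemma monomialZ_mul_commutator (hq0 : q ≠ 0) (n : ℤ) :
    monomialZ a b n * (a * b - b * a) = (q ^ n • (a * b - b * a)) * monomialZ a b n := by
  have aux {x : R} {k : K} (h : x * (a * b - b * a) = (k • (a * b - b * a)) * x) (m : ℕ) :
      x ^ m * (a * b - b * a) = (k ^ m • (a * b - b * a)) * x ^ m := by
    induction m with
    | zero => simp
    | succ m ih =>
      rw [pow_succ, mul_assoc, h, ← mul_assoc, mul_smul_comm, ih, smul_mul_assoc, smul_mul_assoc,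
        smul_mul_assoc, smul_mul_assoc, smul_smul, mul_assoc, pow_succ, mul_comm k]
  rcases n with n | n
  · simpa [monomialZ] using aux (left_mul_commutator hrel) n
  · have := aux (right_mul_commutator hrel hq0) (n + 1)
    rwa [inv_pow, ← zpow_negSucc] at this

end Relations

section Independence

lemma exists_isRoot_pow_mul {k : K} (hk0 : k ≠ 0) (hk : ∀ n : ℕ, 0 < n → k ^ n ≠ 1)
    {r : K[X]} (hr : r ≠ 0) {z : K} (hz : z ≠ 0) (hroot : r.IsRoot z) :
    ∃ n : ℕ, r.IsRoot (k ^ n * z) ∧ ¬ r.IsRoot (k ^ (n + 1) * z) := by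
  by_contra! h
  have hall (n : ℕ) : r.IsRoot (k ^ n * z) := by
    induction n with
    | zero => simpa using hroot
    | succ n ih => exact h n ih
  have hinj : Function.Injective fun n : ℕ => k ^ n * z := by
    intro m n hmn
    replace hmn : k ^ m = k ^ n := mul_right_cancel₀ hz hmn
    wlog hle : m ≤ n generalizing m n
    · exact (this hmn.symm (le_of_not_ge hle)).symm
    by_contra hne
    refine hk (n - m) (by omega) (mul_left_cancel₀ (pow_ne_zero m hk0) ?_)
    rw [← pow_add, Nat.add_sub_cancel' hle, mul_one, hmn]
  refine Set.infinite_range_of_injective hinj ((finite_setOfPred_isRoot hr).subset ?_)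
  rintro _ ⟨n, rfl⟩
  exact hall n

variable (hrel : a * b - q • (b * a) = 1) (hq0 : q ≠ 0) (hq : ∀ n : ℕ, 0 < n → q ^ n ≠ 1)
include hrel hq0 hq

/-- If the commutator is algebraic, it is nilpotent. -/
lemma exists_commutator_pow_eq_zero [IsAlgClosed K] (h : IsIntegral K (a * b - b * a)) :
    ∃ n : ℕ, (a * b - b * a) ^ n = 0 := by
  have hq1 : q ≠ 1 := by simpa using hq 1 one_pos
  set r := minpoly K (a * b - b * a)
  have hr0 : r ≠ 0 := minpoly.ne_zero h
  have hrc : aeval (a * b - b * a) r = 0 := minpoly.aeval K _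
  have hup {z : K} (hz : r.IsRoot z) : r.IsRoot (q * z) ∨ q * z = 1 := by
    have hd : r ∣ r.comp (C q * X) * (C (q - 1)⁻¹ * (C q * X - C 1)) := by
      refine minpoly.dvd K _ ?_
      rw [map_mul, ← left_mul_right_eq_aeval hrel hq1, ← aeval_smul_eq_comp, ← mul_assoc,
        ← mul_aeval_of_mul_eq (left_mul_commutator hrel), hrc, mul_zero, zero_mul]
    have := hz.dvd hd
    simpa [IsRoot, eval_comp, sub_eq_zero, hq1] using this
  have hdown {z : K} (hz : r.IsRoot z) : r.IsRoot (q⁻¹ * z) ∨ z = 1 := by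
    have hd : r ∣ r.comp (C q⁻¹ * X) * (C (q - 1)⁻¹ * (X - C 1)) := by
      refine minpoly.dvd K _ ?_
      rw [map_mul, ← right_mul_left_eq_aeval hrel hq1, ← aeval_smul_eq_comp, ← mul_assoc,
        ← mul_aeval_of_mul_eq (right_mul_commutator hrel hq0), hrc, mul_zero, zero_mul]
    have := hz.dvd hd
    simpa [IsRoot, eval_comp, sub_eq_zero, hq1] using this
  have hroots : ∀ z ∈ r.roots, z = 0 := by
    intro z hz
    have hz := isRoot_of_mem_roots hz
    by_contra hz0
    obtain ⟨m, hm, hm'⟩ := exists_isRoot_pow_mul hq0 hq hr0 hz0 hz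
    obtain ⟨n, hn, hn'⟩ := exists_isRoot_pow_mul (inv_ne_zero hq0)
      (fun n hn => by simpa using hq n hn) hr0 hz0 hz
    rw [pow_succ', mul_assoc] at hm' hn'
    have e1 := (hup hm).resolve_left hm'
    have e2 := (hdown hn).resolve_left hn'
    rw [inv_pow, inv_mul_eq_one₀ (pow_ne_zero n hq0)] at e2
    refine hq (1 + m + n) (by omega) ?_
    rw [pow_add, pow_add, pow_one, mul_assoc, e2, e1]
  have hprod := (IsAlgClosed.splits r).eq_prod_roots_of_monic (minpoly.monic h)
  rw [Multiset.eq_replicate_card.mpr hroots] at hprod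
  refine ⟨r.roots.card, ?_⟩
  rw [hprod] at hrc
  simpa using hrc

variable [IsAlgClosed K] (hpow : ∀ n : ℕ, (a * b - b * a) ^ n ≠ 0)
include hpow

lemma eq_zero_of_aeval_commutator_mul_monomialZ_eq_zero (n : ℤ) :
    ∀ p : K[X], aeval (a * b - b * a) p * monomialZ a b n = 0 → p = 0 := by
  have hq1 : q ≠ 1 := by simpa using hq 1 one_pos
  induction n using Int.induction_on with
  | zero =>
    intro p hp
    by_contra hp0
    have halg : IsAlgebraic K (a * b - b * a) := ⟨p, hp0, by simpa [monomialZ] using hp⟩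
    obtain ⟨n, hn⟩ := exists_commutator_pow_eq_zero hrel hq0 hq halg.isIntegral
    exact hpow n hn
  | succ n ih =>
    intro p hp
    obtain ⟨r, hr, h⟩ := exists_right_mul_aeval_mul_monomialZ hrel hq0 hq1 (n + 1) p
    rw [hp, mul_zero, add_sub_cancel_right] at h
    exact not_imp_not.mp hr (ih r h.symm)
  | pred n ih =>
    intro p hp
    obtain ⟨r, hr, h⟩ := exists_left_mul_aeval_mul_monomialZ hrel hq0 hq1 (-n - 1) p
    rw [hp, mul_zero, sub_add_cancel] at h
    exact not_imp_not.mp hr (ih r h.symm)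

lemma eq_zero_of_sum_eq_zero (s : Finset ℤ) :
    ∀ p : ℤ → K[X], ∑ n ∈ s, aeval (a * b - b * a) (p n) * monomialZ a b n = 0 →
      ∀ n ∈ s, p n = 0 := by
  induction s using Finset.induction_on with
  | empty => simp
  | insert m s hm ih =>
    intro p hp
    have hterm (n : ℤ) : aeval (a * b - b * a) (p n * (C (q ^ m - q ^ n) * X)) * monomialZ a b n =
        q ^ m • ((a * b - b * a) * (aeval (a * b - b * a) (p n) * monomialZ a b n)) -
          aeval (a * b - b * a) (p n) * monomialZ a b n * (a * b - b * a) := by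
      have hc : (a * b - b * a) * aeval (a * b - b * a) (p n) =
          aeval (a * b - b * a) (p n) * (a * b - b * a) := mul_aeval_of_mul_eq rfl (p n)
      rw [mul_assoc _ (monomialZ a b n), monomialZ_mul_commutator hrel hq0,
        ← mul_assoc (a * b - b * a) (aeval _ (p n)), hc]
      simp only [map_mul, aeval_C, aeval_X, ← Algebra.smul_def, sub_smul, mul_sub, sub_mul,
        smul_mul_assoc, mul_smul_comm, mul_assoc]
      module
    have hs : ∀ n ∈ s, p n = 0 := by
      intro n hn
      have hsum : ∑ n ∈ s, aeval (a * b - b * a) (p n * (C (q ^ m - q ^ n) * X)) *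
          monomialZ a b n = 0 := by
        have : ∑ n ∈ insert m s, aeval (a * b - b * a) (p n * (C (q ^ m - q ^ n) * X)) *
            monomialZ a b n = 0 := by
          simp_rw [hterm]
          rw [Finset.sum_sub_distrib, ← Finset.smul_sum, ← Finset.mul_sum, ← Finset.sum_mul, hp]
          simp
        rwa [Finset.sum_insert hm, sub_self, C_0, zero_mul, mul_zero, map_zero, zero_mul,
          zero_add] at this
      have hzero := ih _ hsum n hn
      refine (mul_eq_zero.mp hzero).resolve_right (mul_ne_zero (C_ne_zero.mpr ?_) X_ne_zero)
      have hinj : ∀ i j : ℤ, i < j → q ^ i ≠ q ^ j := by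
        intro i j hij h
        refine hq (j - i).toNat (by omega) ?_
        rw [← zpow_natCast, Int.toNat_of_nonneg (by omega), zpow_sub₀ hq0, h,
          div_self (zpow_ne_zero j hq0)]
      have hne : m ≠ n := fun h => hm (h ▸ hn)
      rcases lt_or_gt_of_ne hne with hlt | hlt
      · exact sub_ne_zero.mpr (hinj m n hlt)
      · exact sub_ne_zero.mpr (hinj n m hlt).symm
    intro n hn
    rcases Finset.mem_insert.mp hn with rfl | hn
    · rw [Finset.sum_insert hm, Finset.sum_eq_zero fun i hi => by simp [hs i hi], add_zero] at hp
      exact eq_zero_of_aeval_commutator_mul_monomialZ_eq_zero hrel hq0 hq hpow n _ hp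
    · exact hs n hn

/-- Normal forms are unique when no power of the commutator vanishes. -/
lemma normalForm_injective : Function.Injective (normalForm K a b) := by
  rw [injective_iff_map_eq_zero]
  intro f hf
  have := eq_zero_of_sum_eq_zero hrel hq0 hq hpow f.support f hf
  ext1 n
  by_cases hn : n ∈ f.support
  · exact this n hn
  · exact Finsupp.notMem_support_iff.mp hn

end Independence

end General

lemma genA_mul_genB (q : ℂ) : genA q * genB q - q • (genB q * genA q) = 1 := by
  have h := RingQuot.mkAlgHom_rel ℂ (HRel.rel (q := q))
  simp only [map_mul, map_add, map_smul, map_one] at h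
  rw [sub_eq_iff_eq_add']
  exact h

lemma adjoin_genA_genB (q : ℂ) : Algebra.adjoin ℂ ({genA q, genB q} : Set (HAlg q)) = ⊤ := by
  have hrange : Set.range (FreeAlgebra.ι ℂ) =
      ({FreeAlgebra.ι ℂ HGen.A, FreeAlgebra.ι ℂ HGen.B} : Set (FreeAlgebra ℂ HGen)) := by
    ext x
    constructor
    · rintro ⟨_ | _, rfl⟩ <;> simp
    · rintro (rfl | rfl) <;> exact ⟨_, rfl⟩
  have h := congrArg (Subalgebra.map (RingQuot.mkAlgHom ℂ (HRel q)))
    (FreeAlgebra.adjoin_range_ι ℂ HGen)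
  rw [AlgHom.map_adjoin, hrange, Set.image_pair, Algebra.map_top,
    (AlgHom.range_eq_top _).mpr (RingQuot.mkAlgHom_surjective ℂ (HRel q))] at h
  exact h

lemma algHom_injective {R : Type*} [Ring R] [Algebra ℂ R] {q : ℂ} (hq0 : q ≠ 0)
    (hq : ∀ n : ℕ, 0 < n → q ^ n ≠ 1) (Ψ : HAlg q →ₐ[ℂ] R)
    (hpow : ∀ n : ℕ, Ψ (genC q) ^ n ≠ 0) : Function.Injective Ψ := by
  rw [injective_iff_map_eq_zero]
  intro x hx
  have hrel : Ψ (genA q) * Ψ (genB q) - q • (Ψ (genB q) * Ψ (genA q)) = 1 := by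
    simpa using congrArg Ψ (genA_mul_genB q)
  obtain ⟨f, rfl⟩ := mem_range_normalForm (genA_mul_genB q) hq0 (by simpa using hq 1 one_pos)
    (x := x) (by rw [adjoin_genA_genB]; exact Algebra.mem_top)
  rw [map_normalForm] at hx
  have hinj := normalForm_injective hrel hq0 hq (by simpa [genC] using hpow)
  rw [hinj (hx.trans (map_zero _).symm), map_zero]

lemma existsUnique_algHom {R : Type*} [Ring R] [Algebra ℂ R] {q : ℂ} {a b : R}
    (hrel : a * b - q • (b * a) = 1) :
    ∃! Ψ : HAlg q →ₐ[ℂ] R, Ψ (genA q) = a ∧ Ψ (genB q) = b := by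
  let φ : FreeAlgebra ℂ HGen →ₐ[ℂ] R :=
    FreeAlgebra.lift ℂ fun g => match g with
      | HGen.A => a
      | HGen.B => b
  have hφ : ∀ ⦃x y⦄, HRel q x y → φ x = φ y := by
    rintro _ _ ⟨⟩
    simpa [φ] using sub_eq_iff_eq_add'.mp hrel
  refine ⟨RingQuot.liftAlgHom ℂ ⟨φ, hφ⟩, by simp [genA, genB, φ], ?_⟩
  rintro Ψ ⟨hA, hB⟩
  refine AlgHom.ext_of_adjoin_eq_top (adjoin_genA_genB q) ?_
  rintro _ (rfl | rfl)
  · rw [hA]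
    simp [genA, φ]
  · rw [hB]
    simp [genB, φ]

end QHeisenberg


/-- If `q ≠ 0` is not a root of unity and `a, a⁺ ∈ B(ℓ²)` satisfy
`a·a⁺ - q·a⁺·a = 1` and `(a·a⁺ - a⁺·a)^n ≠ 0` for all `n`, then the unique unital
`ℂ`-algebra homomorphism `Ψ : H(q) → B(ℓ²)` with `Ψ(A) = a`, `Ψ(B) = a⁺` is injective;
consequently the unital subalgebra of `B(ℓ²)` generated by `a` and `a⁺` is
isomorphic to `H(q)`. -/
theorem statement_0 (q : ℂ) (hq0 : q ≠ 0) (hq1 : ∀ n : ℕ, 0 < n → q ^ n ≠ 1)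
    (a aPlus : BoundedOps)
    (hrel : a * aPlus - q • (aPlus * a) = 1)
    (hpow : ∀ n : ℕ, (a * aPlus - aPlus * a) ^ n ≠ 0) :
    (∃! Ψ : HAlg q →ₐ[ℂ] BoundedOps, Ψ (genA q) = a ∧ Ψ (genB q) = aPlus) ∧
    (∀ Ψ : HAlg q →ₐ[ℂ] BoundedOps, Ψ (genA q) = a → Ψ (genB q) = aPlus →
      Function.Injective Ψ) ∧
    Nonempty (HAlg q ≃ₐ[ℂ] Algebra.adjoin ℂ ({a, aPlus} : Set BoundedOps)) := by
  obtain ⟨Ψ, ⟨hA, hB⟩, hunique⟩ := QHeisenberg.existsUnique_algHom hrel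
  have hinj : ∀ Ψ : HAlg q →ₐ[ℂ] BoundedOps, Ψ (genA q) = a → Ψ (genB q) = aPlus →
      Function.Injective Ψ := fun Ψ hA hB =>
    QHeisenberg.algHom_injective hq0 hq1 Ψ (by simpa [genC, hA, hB] using hpow)
  have hrange : Ψ.range = Algebra.adjoin ℂ ({a, aPlus} : Set BoundedOps) := by
    rw [← Algebra.map_top, ← QHeisenberg.adjoin_genA_genB, AlgHom.map_adjoin, Set.image_pair,
      hA, hB]
  exact ⟨⟨Ψ, ⟨hA, hB⟩, hunique⟩, hinj,
    ⟨(AlgEquiv.ofInjective Ψ (hinj Ψ hA hB)).trans (Subalgebra.equivOfEq _ _ hrange)⟩⟩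
end
end

section
/- The following elements form a ℂ-vector-space basis of P: the elements K^h C^k A^l and K^h C^k B^l with h, k ∈ ℕ and l ≥ 1, together with the elements K^h C^k with h, k ∈ ℕ (this includes 1 = K⁰C⁰), subject in all cases to the condition that k ≥ 1 implies h ∈ {0, 1}. -/
noncomputable section

/-- Generators of the algebra `P`. -/
inductive PGen : Type
  | K : PGen
  | A : PGen
  | B : PGen
  | C : PGen

/- The defining relations of the algebra `P`, where `q = p ^ 2`:
`(1 - q)AB = 1 - qC`, `(1 - q)BA = 1 - C`, `AC = qCA`, `qBC = CB` (i.e. `BC = q⁻¹CB`),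
`pAK = KA` (i.e. `AK = p⁻¹KA`), `BK = pKB`, `CK = KC`, `K²C = 1`. -/
open FreeAlgebra in
inductive PRel (p : ℂ) : FreeAlgebra ℂ PGen → FreeAlgebra ℂ PGen → Prop
  | ab : PRel p ((1 - p ^ 2) • (ι ℂ PGen.A * ι ℂ PGen.B)) (1 - p ^ 2 • ι ℂ PGen.C)
  | ba : PRel p ((1 - p ^ 2) • (ι ℂ PGen.B * ι ℂ PGen.A)) (1 - ι ℂ PGen.C)
  | ac : PRel p (ι ℂ PGen.A * ι ℂ PGen.C) (p ^ 2 • (ι ℂ PGen.C * ι ℂ PGen.A))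
  | bc : PRel p (p ^ 2 • (ι ℂ PGen.B * ι ℂ PGen.C)) (ι ℂ PGen.C * ι ℂ PGen.B)
  | ak : PRel p (p • (ι ℂ PGen.A * ι ℂ PGen.K)) (ι ℂ PGen.K * ι ℂ PGen.A)
  | bk : PRel p (ι ℂ PGen.B * ι ℂ PGen.K) (p • (ι ℂ PGen.K * ι ℂ PGen.B))
  | ck : PRel p (ι ℂ PGen.C * ι ℂ PGen.K) (ι ℂ PGen.K * ι ℂ PGen.C)
  | k2c : PRel p (ι ℂ PGen.K * ι ℂ PGen.K * ι ℂ PGen.C) 1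

/-- The unital associative `ℂ`-algebra `P`, presented by generators `K, A, B, C`
and the relations above. -/
abbrev PAlg (p : ℂ) := RingQuot (PRel p)

/-- The generator `K` of `P`. -/
def pK (p : ℂ) : PAlg p := RingQuot.mkAlgHom ℂ (PRel p) (FreeAlgebra.ι ℂ PGen.K)

/-- The generator `A` of `P`. -/
def pA (p : ℂ) : PAlg p := RingQuot.mkAlgHom ℂ (PRel p) (FreeAlgebra.ι ℂ PGen.A)

/-- The generator `B` of `P`. -/
def pB (p : ℂ) : PAlg p := RingQuot.mkAlgHom ℂ (PRel p) (FreeAlgebra.ι ℂ PGen.B)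

/-- The generator `C` of `P`. -/
def pC (p : ℂ) : PAlg p := RingQuot.mkAlgHom ℂ (PRel p) (FreeAlgebra.ι ℂ PGen.C)
/-- The candidate basis element of `P` indexed by `(h, k, z) : ℕ × ℕ × ℤ`:
`K^h C^k A^(-z)` if `z < 0`, `K^h C^k B^z` if `z > 0`, and `K^h C^k` if `z = 0`. -/
def pBasisElt (p : ℂ) (t : ℕ × ℕ × ℤ) : PAlg p :=
  pK p ^ t.1 * pC p ^ t.2.1 *
    (if t.2.2 < 0 then pA p ^ (-t.2.2).toNat else pB p ^ t.2.2.toNat)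

/-- The index set of the basis of `P`: triples `(h, k, z)` subject to the condition
that `k ≥ 1` implies `h ∈ {0, 1}`.  Here `z < 0` encodes `K^h C^k A^(-z)`, `z > 0`
encodes `K^h C^k B^z`, and `z = 0` encodes `K^h C^k` (with `(0,0,0)` encoding `1`). -/
def PIdx : Type := {t : ℕ × ℕ × ℤ // 1 ≤ t.2.1 → t.1 ≤ 1}

namespace PAlg

open Finsupp

/-! ### The left regular representation on the candidate basis -/

/-- The space with basis indexed by pairs `(m, n)`, standing for `K^m B^n` if `n ≥ 0` and
`K^m A^(-n)` if `n < 0`. -/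
abbrev Model : Type := ℤ × ℤ →₀ ℂ

/-- The basis vectors of `Model`. -/
def vec (m n : ℤ) : Model := single (m, n) 1

/-- The linear map out of `Model` with prescribed values on the basis vectors. -/
def extend {M : Type*} [AddCommGroup M] [Module ℂ M] (f : ℤ → ℤ → M) : Model →ₗ[ℂ] M :=
  linearCombination ℂ fun t : ℤ × ℤ => f t.1 t.2

@[simp]
lemma extend_vec {M : Type*} [AddCommGroup M] [Module ℂ M] (f : ℤ → ℤ → M) (m n : ℤ) :
    extend f (vec m n) = f m n := by
  simp [extend, vec]

lemma hom_ext {M : Type*} [AddCommGroup M] [Module ℂ M] {f g : Model →ₗ[ℂ] M}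
    (h : ∀ m n, f (vec m n) = g (vec m n)) : f = g := by
  ext ⟨m, n⟩
  simpa [vec] using h m n

/-- Left multiplication by `K` on `Model`. -/
def opK : Module.End ℂ Model := extend fun m n => vec (m + 1) n

/-- Left multiplication by `C` on `Model`. -/
def opC : Module.End ℂ Model := extend fun m n => vec (m - 2) n

/-- Left multiplication by `A` on `Model`. -/
def opA (p : ℂ) : Module.End ℂ Model := extend fun m n =>
  if 0 < n then (p⁻¹ ^ m / (1 - p ^ 2)) • (vec m (n - 1) - p ^ 2 • vec (m - 2) (n - 1))
  else p⁻¹ ^ m • vec m (n - 1)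

/-- Left multiplication by `B` on `Model`. -/
def opB (p : ℂ) : Module.End ℂ Model := extend fun m n =>
  if n < 0 then (p ^ m / (1 - p ^ 2)) • (vec m (n + 1) - vec (m - 2) (n + 1))
  else p ^ m • vec m (n + 1)

@[simp]
lemma opK_vec (m n : ℤ) : opK (vec m n) = vec (m + 1) n := extend_vec _ m n

@[simp]
lemma opC_vec (m n : ℤ) : opC (vec m n) = vec (m - 2) n := extend_vec _ m n

lemma opA_vec_of_pos (p : ℂ) (m : ℤ) {n : ℤ} (hn : 0 < n) :
    opA p (vec m n) =
      (p⁻¹ ^ m / (1 - p ^ 2)) • (vec m (n - 1) - p ^ 2 • vec (m - 2) (n - 1)) := by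
  rw [opA, extend_vec, if_pos hn]

lemma opA_vec_of_nonpos (p : ℂ) (m : ℤ) {n : ℤ} (hn : n ≤ 0) :
    opA p (vec m n) = p⁻¹ ^ m • vec m (n - 1) := by
  rw [opA, extend_vec, if_neg hn.not_gt]

lemma opB_vec_of_neg (p : ℂ) (m : ℤ) {n : ℤ} (hn : n < 0) :
    opB p (vec m n) = (p ^ m / (1 - p ^ 2)) • (vec m (n + 1) - vec (m - 2) (n + 1)) := by
  rw [opB, extend_vec, if_pos hn]

lemma opB_vec_of_nonneg (p : ℂ) (m : ℤ) {n : ℤ} (hn : 0 ≤ n) :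
    opB p (vec m n) = p ^ m • vec m (n + 1) := by
  rw [opB, extend_vec, if_neg hn.not_gt]

variable {p : ℂ}

lemma opA_opB (hp : p ≠ 0) (hp2 : 1 - p ^ 2 ≠ 0) :
    (1 - p ^ 2) • (opA p * opB p) = 1 - p ^ 2 • opC := by
  refine hom_ext fun m n => ?_
  have hm : p ^ m ≠ 0 := zpow_ne_zero m hp
  rcases lt_or_ge n 0 with hn | hn
  · simp only [LinearMap.smul_apply, Module.End.mul_apply, LinearMap.sub_apply,
      Module.End.one_apply, opC_vec, opB_vec_of_neg p m hn, map_smul, map_sub,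
      opA_vec_of_nonpos p _ (show n + 1 ≤ 0 by lia), add_sub_cancel_right, inv_zpow,
      zpow_sub₀ hp, zpow_ofNat]
    match_scalars <;> field_simp
  · simp only [LinearMap.smul_apply, Module.End.mul_apply, LinearMap.sub_apply,
      Module.End.one_apply, opC_vec, opB_vec_of_nonneg p m hn, map_smul,
      opA_vec_of_pos p _ (show 0 < n + 1 by lia), add_sub_cancel_right, inv_zpow]
    match_scalars <;> field_simp

lemma opB_opA (hp : p ≠ 0) (hp2 : 1 - p ^ 2 ≠ 0) :
    (1 - p ^ 2) • (opB p * opA p) = 1 - opC := by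
  refine hom_ext fun m n => ?_
  have hm : p ^ m ≠ 0 := zpow_ne_zero m hp
  rcases lt_or_ge 0 n with hn | hn
  · simp only [LinearMap.smul_apply, Module.End.mul_apply, LinearMap.sub_apply,
      Module.End.one_apply, opC_vec, opA_vec_of_pos p m hn, map_smul, map_sub,
      opB_vec_of_nonneg p _ (show 0 ≤ n - 1 by lia), sub_add_cancel, inv_zpow,
      zpow_sub₀ hp, zpow_ofNat]
    match_scalars <;> field_simp
  · simp only [LinearMap.smul_apply, Module.End.mul_apply, LinearMap.sub_apply,
      Module.End.one_apply, opC_vec, opA_vec_of_nonpos p m hn, map_smul,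
      opB_vec_of_neg p _ (show n - 1 < 0 by lia), sub_add_cancel, inv_zpow]
    match_scalars <;> field_simp

lemma opA_opC (hp : p ≠ 0) : opA p * opC = p ^ 2 • (opC * opA p) := by
  refine hom_ext fun m n => ?_
  rcases lt_or_ge 0 n with hn | hn
  · simp only [LinearMap.smul_apply, Module.End.mul_apply, opC_vec, opA_vec_of_pos p _ hn,
      map_smul, map_sub, inv_zpow, zpow_sub₀ hp, zpow_ofNat]
    match_scalars <;> field_simp
  · simp only [LinearMap.smul_apply, Module.End.mul_apply, opC_vec, opA_vec_of_nonpos p _ hn,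
      map_smul, inv_zpow, zpow_sub₀ hp, zpow_ofNat]
    match_scalars
    field_simp

lemma opB_opC (hp : p ≠ 0) : p ^ 2 • (opB p * opC) = opC * opB p := by
  refine hom_ext fun m n => ?_
  rcases lt_or_ge n 0 with hn | hn
  · simp only [LinearMap.smul_apply, Module.End.mul_apply, opC_vec, opB_vec_of_neg p _ hn,
      map_smul, map_sub, zpow_sub₀ hp, zpow_ofNat]
    match_scalars <;> field_simp
  · simp only [LinearMap.smul_apply, Module.End.mul_apply, opC_vec, opB_vec_of_nonneg p _ hn,
      map_smul, zpow_sub₀ hp, zpow_ofNat]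
    match_scalars
    field_simp

lemma opA_opK (hp : p ≠ 0) : p • (opA p * opK) = opK * opA p := by
  refine hom_ext fun m n => ?_
  rcases lt_or_ge 0 n with hn | hn
  · simp only [LinearMap.smul_apply, Module.End.mul_apply, opK_vec, opA_vec_of_pos p _ hn,
      map_smul, map_sub, inv_zpow, zpow_add_one₀ hp, add_sub_right_comm]
    match_scalars <;> field_simp
  · simp only [LinearMap.smul_apply, Module.End.mul_apply, opK_vec, opA_vec_of_nonpos p _ hn,
      map_smul, inv_zpow, zpow_add_one₀ hp]
    match_scalars
    field_simp

lemma opB_opK (hp : p ≠ 0) : opB p * opK = p • (opK * opB p) := by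
  refine hom_ext fun m n => ?_
  rcases lt_or_ge n 0 with hn | hn
  · simp only [LinearMap.smul_apply, Module.End.mul_apply, opK_vec, opB_vec_of_neg p _ hn,
      map_smul, map_sub, zpow_add_one₀ hp, add_sub_right_comm]
    match_scalars <;> field_simp
  · simp only [LinearMap.smul_apply, Module.End.mul_apply, opK_vec, opB_vec_of_nonneg p _ hn,
      map_smul, zpow_add_one₀ hp]
    match_scalars
    field_simp

lemma opC_opK : opC * opK = opK * opC :=
  hom_ext fun m n => by simp [add_sub_right_comm]

lemma opK_opK_opC : opK * opK * opC = 1 :=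
  hom_ext fun m n => by
    simp only [Module.End.mul_apply, Module.End.one_apply, opC_vec, opK_vec]
    ring_nf

/-- The operators on `Model` by which the generators act. -/
def genOp (p : ℂ) : PGen → Module.End ℂ Model
  | .K => opK
  | .A => opA p
  | .B => opB p
  | .C => opC

/-- The representation of `P` on `Model`. -/
def rep (hp : p ≠ 0) (hp2 : 1 - p ^ 2 ≠ 0) : PAlg p →ₐ[ℂ] Module.End ℂ Model :=
  RingQuot.liftAlgHom ℂ ⟨FreeAlgebra.lift ℂ (genOp p), fun x y h => by
    induction h <;>
      simp only [map_smul, map_mul, map_sub, map_one, FreeAlgebra.lift_ι_apply, genOp]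
    · exact opA_opB hp hp2
    · exact opB_opA hp hp2
    · exact opA_opC hp
    · exact opB_opC hp
    · exact opA_opK hp
    · exact opB_opK hp
    · exact opC_opK
    · exact opK_opK_opC⟩

lemma rep_mk (hp : p ≠ 0) (hp2 : 1 - p ^ 2 ≠ 0) (g : PGen) :
    rep hp hp2 (RingQuot.mkAlgHom ℂ (PRel p) (FreeAlgebra.ι ℂ g)) = genOp p g := by
  rw [rep, RingQuot.liftAlgHom_mkAlgHom_apply, FreeAlgebra.lift_ι_apply]

lemma opA_pow_vec (p : ℂ) (l : ℕ) : (opA p ^ l) (vec 0 0) = vec 0 (-l) := by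
  induction l with
  | zero => simp
  | succ l ih =>
    rw [pow_succ', Module.End.mul_apply, ih, opA_vec_of_nonpos p 0 (by lia), zpow_zero, one_smul]
    congr 1
    lia

lemma opB_pow_vec (p : ℂ) (l : ℕ) : (opB p ^ l) (vec 0 0) = vec 0 l := by
  induction l with
  | zero => simp
  | succ l ih =>
    rw [pow_succ', Module.End.mul_apply, ih, opB_vec_of_nonneg p 0 (by lia), zpow_zero, one_smul]
    congr 1

lemma opC_pow_vec (k : ℕ) (m n : ℤ) : (opC ^ k) (vec m n) = vec (m - 2 * k) n := by
  induction k with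
  | zero => simp
  | succ k ih =>
    rw [pow_succ', Module.End.mul_apply, ih, opC_vec]
    congr 1
    push_cast
    ring

lemma opK_pow_vec (h : ℕ) (m n : ℤ) : (opK ^ h) (vec m n) = vec (m + h) n := by
  induction h with
  | zero => simp
  | succ h ih =>
    rw [pow_succ', Module.End.mul_apply, ih, opK_vec]
    congr 1
    push_cast
    ring

lemma rep_pBasisElt (hp : p ≠ 0) (hp2 : 1 - p ^ 2 ≠ 0) (t : ℕ × ℕ × ℤ) :
    rep hp hp2 (pBasisElt p t) (vec 0 0) = vec (t.1 - 2 * t.2.1) t.2.2 := by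
  obtain ⟨h, k, z⟩ := t
  simp only [pBasisElt, apply_ite (rep hp hp2), map_mul, map_pow, pK, pA, pB, pC, rep_mk, genOp,
    Module.End.mul_apply]
  have key : (if z < 0 then opA p ^ (-z).toNat else opB p ^ z.toNat) (vec 0 0) = vec 0 z := by
    split_ifs with hz
    · rw [opA_pow_vec]
      congr 1
      lia
    · rw [opB_pow_vec]
      congr 1
      lia
  rw [key, opC_pow_vec, opK_pow_vec]
  congr 1
  ring

/-! ### Indexing the candidate basis by exponents -/

/-- The exponents `(m, n)` such that `t` encodes `K^m B^n` or `K^m A^(-n)`, where `C = K^(-2)`. -/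
def exponents (t : PIdx) : ℤ × ℤ := (t.1.1 - 2 * t.1.2.1, t.1.2.2)

lemma exponents_injective : Function.Injective exponents := by
  rintro ⟨⟨h, k, z⟩, ht⟩ ⟨⟨h', k', z'⟩, ht'⟩ e
  simp only [exponents, Prod.mk.injEq] at e ht ht'
  apply Subtype.ext
  simp only [Prod.mk.injEq]
  lia

lemma exponents_surjective : Function.Surjective exponents := by
  rintro ⟨m, n⟩
  rcases le_or_gt 0 m with hm | hm
  · exact ⟨⟨(m.toNat, 0, n), fun h => absurd h (by simp)⟩, by simp [exponents, hm]⟩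
  · refine ⟨⟨((m % 2).toNat, ((1 - m) / 2).toNat, n), fun _ => ?_⟩, ?_⟩
    · change (m % 2).toNat ≤ 1
      lia
    · simp only [exponents, Prod.mk.injEq, and_true]
      lia

lemma linearIndependent_pBasisElt (hp : p ≠ 0) (hp2 : 1 - p ^ 2 ≠ 0) :
    LinearIndependent ℂ fun t : PIdx => pBasisElt p t.1 := by
  refine LinearIndependent.of_comp
    ((LinearMap.applyₗ (vec 0 0)).comp (rep hp hp2).toLinearMap) ?_
  convert (Finsupp.linearIndependent_single_one ℂ (ℤ × ℤ)).comp exponents exponents_injective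
    using 1
  funext t
  exact rep_pBasisElt hp hp2 t.1

/-! ### Spanning -/

lemma pA_mul_pB (p : ℂ) : (1 - p ^ 2) • (pA p * pB p) = 1 - p ^ 2 • pC p := by
  simpa [pA, pB, pC, pK] using RingQuot.mkAlgHom_rel ℂ (PRel.ab (p := p))

lemma pB_mul_pA (p : ℂ) : (1 - p ^ 2) • (pB p * pA p) = 1 - pC p := by
  simpa [pA, pB, pC, pK] using RingQuot.mkAlgHom_rel ℂ (PRel.ba (p := p))

lemma pA_mul_pK (p : ℂ) : p • (pA p * pK p) = pK p * pA p := by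
  simpa [pA, pB, pC, pK] using RingQuot.mkAlgHom_rel ℂ (PRel.ak (p := p))

lemma pB_mul_pK (p : ℂ) : pB p * pK p = p • (pK p * pB p) := by
  simpa [pA, pB, pC, pK] using RingQuot.mkAlgHom_rel ℂ (PRel.bk (p := p))

lemma pC_mul_pK (p : ℂ) : pC p * pK p = pK p * pC p := by
  simpa [pA, pB, pC, pK] using RingQuot.mkAlgHom_rel ℂ (PRel.ck (p := p))

lemma pK_mul_pK_mul_pC (p : ℂ) : pK p * pK p * pC p = 1 := by
  simpa [pA, pB, pC, pK] using RingQuot.mkAlgHom_rel ℂ (PRel.k2c (p := p))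

/-- The generator `K` as a unit, with inverse `K C`. -/
def unitK (p : ℂ) : (PAlg p)ˣ where
  val := pK p
  inv := pK p * pC p
  val_inv := by rw [← mul_assoc, pK_mul_pK_mul_pC]
  inv_val := by rw [mul_assoc, pC_mul_pK, ← mul_assoc, pK_mul_pK_mul_pC]

lemma pC_eq (p : ℂ) : pC p = ((unitK p ^ (-2 : ℤ) : (PAlg p)ˣ) : PAlg p) := by
  have h : ((unitK p ^ 2 : (PAlg p)ˣ) : PAlg p) * pC p = 1 := by
    rw [Units.val_pow_eq_pow_val, pow_two]
    exact pK_mul_pK_mul_pC p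
  rw [zpow_neg]
  exact (Units.inv_eq_of_mul_eq_one_right h).symm

lemma mul_zpow_of_mul_eq_smul {R : Type*} [Ring R] [Algebra ℂ R] {x : R} {u : Rˣ} {c : ℂ}
    (hc : c ≠ 0) (h : x * u = c • (u * x)) (m : ℤ) :
    x * (u ^ m : Rˣ) = c ^ m • ((u ^ m : Rˣ) * x) := by
  have hinv : x * (u⁻¹ : Rˣ) = c⁻¹ • ((u⁻¹ : Rˣ) * x) := by
    rw [eq_inv_smul_iff₀ hc, Units.eq_inv_mul_iff_mul_eq, mul_smul_comm, ← mul_assoc,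
      ← smul_mul_assoc, ← h, Units.mul_inv_cancel_right]
  induction m with
  | zero => simp
  | succ i ih =>
    rw [zpow_add_one, zpow_add_one₀ hc, Units.val_mul, ← mul_assoc, ih, smul_mul_assoc, mul_assoc,
      h, mul_smul_comm, smul_smul, mul_assoc]
  | pred i ih =>
    rw [zpow_sub_one, zpow_sub_one₀ hc, Units.val_mul, ← mul_assoc, ih, smul_mul_assoc, mul_assoc,
      hinv, mul_smul_comm, smul_smul, mul_assoc]

/-- `B^n` if `n ≥ 0` and `A^(-n)` if `n < 0`. -/
def ladder (p : ℂ) (n : ℤ) : PAlg p := if n < 0 then pA p ^ (-n).toNat else pB p ^ n.toNat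

lemma ladder_natCast (p : ℂ) (n : ℕ) : ladder p n = pB p ^ n := by
  simp [ladder]

lemma ladder_neg_natCast (p : ℂ) (n : ℕ) : ladder p (-n) = pA p ^ n := by
  rcases n.eq_zero_or_pos with rfl | hn
  · simp [ladder]
  · simp [ladder, hn]

lemma pB_mul_ladder (hp2 : 1 - p ^ 2 ≠ 0) (n : ℤ) :
    pB p * ladder p n =
      if n < 0 then (1 - p ^ 2)⁻¹ • ((1 - pC p) * ladder p (n + 1)) else ladder p (n + 1) := by
  split_ifs with hn
  · obtain ⟨l, rfl⟩ : ∃ l : ℕ, n = -((l + 1 : ℕ) : ℤ) := ⟨(-n - 1).toNat, by lia⟩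
    rw [show -((l + 1 : ℕ) : ℤ) + 1 = -(l : ℤ) by lia, ladder_neg_natCast, ladder_neg_natCast,
      eq_inv_smul_iff₀ hp2, pow_succ' (pA p), ← mul_assoc, ← smul_mul_assoc,
      pB_mul_pA]
  · obtain ⟨l, rfl⟩ : ∃ l : ℕ, n = l := ⟨n.toNat, by lia⟩
    rw [← Int.natCast_succ, ladder_natCast, ladder_natCast, pow_succ']

lemma pA_mul_ladder (hp2 : 1 - p ^ 2 ≠ 0) (n : ℤ) :
    pA p * ladder p n =
      if 0 < n then (1 - p ^ 2)⁻¹ • ((1 - p ^ 2 • pC p) * ladder p (n - 1))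
      else ladder p (n - 1) := by
  split_ifs with hn
  · obtain ⟨l, rfl⟩ : ∃ l : ℕ, n = (l + 1 : ℕ) := ⟨(n - 1).toNat, by lia⟩
    rw [show ((l + 1 : ℕ) : ℤ) - 1 = l by lia, ladder_natCast, ladder_natCast,
      eq_inv_smul_iff₀ hp2, pow_succ' (pB p), ← mul_assoc, ← smul_mul_assoc,
      pA_mul_pB]
  · obtain ⟨l, rfl⟩ : ∃ l : ℕ, n = -(l : ℤ) := ⟨(-n).toNat, by lia⟩
    rw [show -(l : ℤ) - 1 = -((l + 1 : ℕ) : ℤ) by lia, ladder_neg_natCast, ladder_neg_natCast,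
      pow_succ']

/-- The element `K^m B^n` (if `n ≥ 0`) or `K^m A^(-n)` (if `n < 0`) of `P`. -/
def monomial (p : ℂ) (m n : ℤ) : PAlg p := (unitK p ^ m : (PAlg p)ˣ) * ladder p n

lemma pBasisElt_eq_monomial (p : ℂ) (t : PIdx) :
    pBasisElt p t.1 = monomial p (exponents t).1 (exponents t).2 := by
  obtain ⟨⟨h, k, z⟩, ht⟩ := t
  have hK : pK p = (unitK p : PAlg p) := rfl
  simp only [pBasisElt, monomial, ladder, exponents]
  rw [pC_eq, hK, ← Units.val_pow_eq_pow_val, ← Units.val_pow_eq_pow_val, ← Units.val_mul,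
    ← zpow_natCast, ← zpow_natCast, ← zpow_mul, ← zpow_add]
  congr 4

/-- The span of all the monomials. -/
def monomialSpan (p : ℂ) : Submodule ℂ (PAlg p) :=
  Submodule.span ℂ (Set.range fun t : ℤ × ℤ => monomial p t.1 t.2)

lemma monomial_mem (p : ℂ) (m n : ℤ) : monomial p m n ∈ monomialSpan p :=
  Submodule.subset_span ⟨(m, n), rfl⟩

lemma unitK_zpow_mul_monomial (p : ℂ) (i m n : ℤ) :
    ((unitK p ^ i : (PAlg p)ˣ) : PAlg p) * monomial p m n = monomial p (i + m) n := by
  rw [monomial, monomial, ← mul_assoc, ← Units.val_mul, ← zpow_add]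

lemma unitK_zpow_mul_pC_mul_ladder (p : ℂ) (m n : ℤ) :
    ((unitK p ^ m : (PAlg p)ˣ) : PAlg p) * (pC p * ladder p n) = monomial p (m - 2) n := by
  rw [pC_eq, ← mul_assoc, ← Units.val_mul, ← zpow_add, ← sub_eq_add_neg, monomial]

lemma pA_mul_monomial_mem (hp : p ≠ 0) (hp2 : 1 - p ^ 2 ≠ 0) (m n : ℤ) :
    pA p * monomial p m n ∈ monomialSpan p := by
  have h : pA p * (unitK p : PAlg p) = p⁻¹ • ((unitK p : PAlg p) * pA p) := by
    rw [eq_inv_smul_iff₀ hp]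
    exact pA_mul_pK p
  rw [monomial, ← mul_assoc, mul_zpow_of_mul_eq_smul (inv_ne_zero hp) h, smul_mul_assoc,
    mul_assoc, pA_mul_ladder hp2]
  refine Submodule.smul_mem _ _ ?_
  split_ifs
  · rw [mul_smul_comm, sub_mul, one_mul, smul_mul_assoc, mul_sub, mul_smul_comm,
      unitK_zpow_mul_pC_mul_ladder]
    exact Submodule.smul_mem _ _
      (sub_mem (monomial_mem p _ _) (Submodule.smul_mem _ _ (monomial_mem p _ _)))
  · exact monomial_mem p _ _

lemma pB_mul_monomial_mem (hp : p ≠ 0) (hp2 : 1 - p ^ 2 ≠ 0) (m n : ℤ) :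
    pB p * monomial p m n ∈ monomialSpan p := by
  rw [monomial, ← mul_assoc, mul_zpow_of_mul_eq_smul (u := unitK p) hp (pB_mul_pK p),
    smul_mul_assoc, mul_assoc, pB_mul_ladder hp2]
  refine Submodule.smul_mem _ _ ?_
  split_ifs
  · rw [mul_smul_comm, sub_mul, one_mul, mul_sub, unitK_zpow_mul_pC_mul_ladder]
    exact Submodule.smul_mem _ _ (sub_mem (monomial_mem p _ _) (monomial_mem p _ _))
  · exact monomial_mem p _ _

lemma generator_mul_monomial_mem (hp : p ≠ 0) (hp2 : 1 - p ^ 2 ≠ 0) (g : PGen) (m n : ℤ) :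
    RingQuot.mkAlgHom ℂ (PRel p) (FreeAlgebra.ι ℂ g) * monomial p m n ∈ monomialSpan p := by
  cases g with
  | K =>
    have h := unitK_zpow_mul_monomial p 1 m n
    rw [zpow_one] at h
    exact h ▸ monomial_mem p (1 + m) n
  | A => exact pA_mul_monomial_mem hp hp2 m n
  | B => exact pB_mul_monomial_mem hp hp2 m n
  | C =>
    have h := unitK_zpow_mul_monomial p (-2) m n
    rw [← pC_eq] at h
    exact h ▸ monomial_mem p (-2 + m) n

lemma mul_mem_monomialSpan (hp : p ≠ 0) (hp2 : 1 - p ^ 2 ≠ 0) (a : FreeAlgebra ℂ PGen) :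
    ∀ x ∈ monomialSpan p, RingQuot.mkAlgHom ℂ (PRel p) a * x ∈ monomialSpan p := by
  induction a with
  | grade0 r =>
    intro x hx
    rw [AlgHom.commutes, ← Algebra.smul_def]
    exact Submodule.smul_mem _ _ hx
  | grade1 g =>
    intro x hx
    induction hx using Submodule.span_induction with
    | mem x hx =>
      obtain ⟨⟨m, n⟩, rfl⟩ := hx
      exact generator_mul_monomial_mem hp hp2 g m n
    | zero => simp
    | add x y _ _ hx hy =>
      rw [mul_add]
      exact add_mem hx hy
    | smul c x _ hx =>
      rw [mul_smul_comm]
      exact Submodule.smul_mem _ _ hx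
  | mul a b ha hb =>
    intro x hx
    rw [map_mul, mul_assoc]
    exact ha _ (hb x hx)
  | add a b ha hb =>
    intro x hx
    rw [map_add, add_mul]
    exact add_mem (ha x hx) (hb x hx)

lemma monomialSpan_eq_top (hp : p ≠ 0) (hp2 : 1 - p ^ 2 ≠ 0) : monomialSpan p = ⊤ := by
  refine (Submodule.eq_top_iff').2 fun x => ?_
  obtain ⟨a, rfl⟩ := RingQuot.mkAlgHom_surjective ℂ (PRel p) x
  have h1 : (1 : PAlg p) ∈ monomialSpan p := by
    simpa [monomial, ladder] using monomial_mem p 0 0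
  simpa using mul_mem_monomialSpan hp hp2 a 1 h1

lemma span_pBasisElt (hp : p ≠ 0) (hp2 : 1 - p ^ 2 ≠ 0) :
    Submodule.span ℂ (Set.range fun t : PIdx => pBasisElt p t.1) = ⊤ := by
  rw [← monomialSpan_eq_top hp hp2, monomialSpan,
    ← exponents_surjective.range_comp fun t : ℤ × ℤ => monomial p t.1 t.2]
  simp only [pBasisElt_eq_monomial, Function.comp_def]

end PAlg

/-- With `ω > 0` and `p = e^{-ω}` (so `q = p² = e^{-2ω}`), the elements
`K^h C^k A^l`, `K^h C^k B^l` (`h, k ∈ ℕ`, `l ≥ 1`) and `K^h C^k` (`h, k ∈ ℕ`), subject to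
the condition that `k ≥ 1` implies `h ∈ {0,1}`, form a `ℂ`-vector-space basis of `P`. -/
theorem statement_1 (ω : ℝ) (hω : 0 < ω) :
    LinearIndependent ℂ
      (fun t : PIdx => pBasisElt (Real.exp (-ω) : ℂ) t.1) ∧
    Submodule.span ℂ
      (Set.range fun t : PIdx => pBasisElt (Real.exp (-ω) : ℂ) t.1) = ⊤ := by
  have hp : (Real.exp (-ω) : ℂ) ≠ 0 := by exact_mod_cast (Real.exp_pos (-ω)).ne'
  have hp2 : 1 - (Real.exp (-ω) : ℂ) ^ 2 ≠ 0 := by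
    have hlt : Real.exp (-ω) ^ 2 < 1 :=
      pow_lt_one₀ (Real.exp_pos _).le (Real.exp_lt_one_iff.2 (neg_lt_zero.2 hω)) two_ne_zero
    exact_mod_cast (sub_pos.2 hlt).ne'
  exact ⟨PAlg.linearIndependent_pBasisElt hp hp2, PAlg.span_pBasisElt hp hp2⟩
end
end

section
/- In H(q), for every k ∈ ℕ, every l ≥ 1 and every n ∈ ℚ, the following identities hold: θ_n(C^k) = q^k(1 − q^{n−k}) C^k A; θ_n(C^k A^l) = q^k(1 − q^{n−k}) C^k A^{l+1}; θ_n(C^k B^l) = q^k·(1 − q^{n−k})/(1 − q) · C^k B^{l−1} − q^{k+1}·(1 − q^{n−k−l})/(1 − q) · C^{k+1} B^{l−1}; η_n(C^k) = q^{−k}(1 − q^{n+k}) C^k B; η_n(C^k B^l) = q^{−k}(1 − q^{n+k}) C^k B^{l+1}; η_n(C^k A^l) = q^{−k}·(1 − q^{n+k})/(1 − q) · C^k A^{l−1} − q^{−k}·(1 − q^{n+k+l})/(1 − q) · C^{k+1} A^{l−1}. -/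
noncomputable section

/-- `q = e^{-2ω}`. -/
def qOf (ω : ℝ) : ℂ := Complex.exp (-2 * (ω : ℂ))

/-- `q^r = e^{-2ωr}` for a rational exponent `r`. -/
def qexp (ω : ℝ) (r : ℚ) : ℂ := Complex.exp (-2 * (ω : ℂ) * (r : ℂ))

/-- The deformed commutator map `θ_n : γ ↦ Aγ - q^n γA` on `H(q)`, `n ∈ ℚ`. -/
def thetaQ (ω : ℝ) (n : ℚ) (x : HAlg (qOf ω)) : HAlg (qOf ω) :=
  genA (qOf ω) * x - qexp ω n • (x * genA (qOf ω))

/-- The deformed commutator map `η_n : γ ↦ Bγ - q^n γB` on `H(q)`, `n ∈ ℚ`. -/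
def etaQ (ω : ℝ) (n : ℚ) (x : HAlg (qOf ω)) : HAlg (qOf ω) :=
  genB (qOf ω) * x - qexp ω n • (x * genB (qOf ω))

section SkewCommute

variable {K R : Type*} [Field K] [Ring R] [Algebra K R] {q : K} {x y a b : R}

theorem mul_pow_of_skew_commute (h : x * y = q • (y * x)) (k : ℕ) :
    x * y ^ k = q ^ k • (y ^ k * x) := by
  induction k with
  | zero => simp
  | succ k ih =>
    rw [pow_succ, ← mul_assoc, ih, smul_mul_assoc, mul_assoc, h, mul_smul_comm, smul_smul,
      ← mul_assoc, ← pow_succ]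

theorem pow_mul_of_skew_commute (h : x * y = q • (y * x)) (k : ℕ) :
    x ^ k * y = q ^ k • (y * x ^ k) := by
  induction k with
  | zero => simp
  | succ k ih =>
    rw [pow_succ', mul_assoc, ih, mul_smul_comm, ← mul_assoc, h, smul_mul_assoc, smul_smul,
      mul_assoc, ← pow_succ]

theorem mul_commutator_of_heisenberg (h : a * b = q • (b * a) + 1) :
    a * (a * b - b * a) = q • ((a * b - b * a) * a) := by
  have h' : a * (b * a) = q • (b * a * a) + a := by
    rw [← mul_assoc, h, add_mul, one_mul, smul_mul_assoc]
  simp only [h, mul_sub, mul_add, sub_mul, add_mul, mul_smul_comm, smul_mul_assoc, h', mul_one,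
    one_mul]
  module

theorem mul_commutator_of_heisenberg' (hq : q ≠ 0) (h : a * b = q • (b * a) + 1) :
    b * (a * b - b * a) = q⁻¹ • ((a * b - b * a) * b) := by
  rw [eq_inv_smul_iff₀ hq]
  have h' : b * a * b = q • (b * (b * a)) + b := by
    rw [mul_assoc, h, mul_add, mul_one, mul_smul_comm]
  simp only [h, mul_sub, mul_add, sub_mul, add_mul, mul_smul_comm, smul_mul_assoc, h', mul_one,
    one_mul]
  module

theorem mul_eq_of_heisenberg (hq : 1 - q ≠ 0) (h : a * b = q • (b * a) + 1) :
    a * b = (1 - q)⁻¹ • (1 - q • (a * b - b * a)) := by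
  rw [eq_inv_smul_iff₀ hq, h]
  module

theorem mul_eq_of_heisenberg' (hq : 1 - q ≠ 0) (h : a * b = q • (b * a) + 1) :
    b * a = (1 - q)⁻¹ • (1 - (a * b - b * a)) := by
  rw [eq_inv_smul_iff₀ hq, h]
  module

end SkewCommute

theorem genA_mul_genB (q : ℂ) : genA q * genB q = q • (genB q * genA q) + 1 := by
  simpa [genA, genB] using RingQuot.mkAlgHom_rel ℂ (HRel.rel (q := q))

theorem qOf_ne_zero (ω : ℝ) : qOf ω ≠ 0 := Complex.exp_ne_zero _

theorem one_sub_qOf_ne_zero {ω : ℝ} (hω : 0 < ω) : 1 - qOf ω ≠ 0 := by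
  have h : qOf ω = (Real.exp (-2 * ω) : ℝ) := by simp [qOf]
  have h' : Real.exp (-2 * ω) < 1 := by simpa using hω
  rw [h, sub_ne_zero]
  exact_mod_cast h'.ne'

theorem qexp_add_natCast (ω : ℝ) (r : ℚ) (m : ℕ) : qexp ω (r + m) = qexp ω r * qOf ω ^ m := by
  rw [qexp, qexp, qOf, ← Complex.exp_nat_mul, ← Complex.exp_add]
  congr 1
  push_cast
  ring

theorem qexp_sub_natCast (ω : ℝ) (r : ℚ) (m : ℕ) : qexp ω (r - m) = qexp ω r / qOf ω ^ m := by
  rw [eq_div_iff (pow_ne_zero _ (qOf_ne_zero ω)), ← qexp_add_natCast, sub_add_cancel]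

/-- The action of the deformed commutator maps `θ_n`, `η_n` (`n ∈ ℚ`)
on the basis elements `C^k`, `C^k A^l`, `C^k B^l` of `H(q)`, where `q = e^{-2ω}`, `ω > 0`. -/
theorem statement_2 (ω : ℝ) (hω : 0 < ω) (k : ℕ) (l : ℕ) (hl : 1 ≤ l) (n : ℚ) :
    thetaQ ω n (genC (qOf ω) ^ k) =
      (qOf ω ^ k * (1 - qexp ω (n - k))) • (genC (qOf ω) ^ k * genA (qOf ω)) ∧
    thetaQ ω n (genC (qOf ω) ^ k * genA (qOf ω) ^ l) =
      (qOf ω ^ k * (1 - qexp ω (n - k))) • (genC (qOf ω) ^ k * genA (qOf ω) ^ (l + 1)) ∧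
    thetaQ ω n (genC (qOf ω) ^ k * genB (qOf ω) ^ l) =
      (qOf ω ^ k * (1 - qexp ω (n - k)) / (1 - qOf ω)) •
        (genC (qOf ω) ^ k * genB (qOf ω) ^ (l - 1)) -
      (qOf ω ^ (k + 1) * (1 - qexp ω (n - k - l)) / (1 - qOf ω)) •
        (genC (qOf ω) ^ (k + 1) * genB (qOf ω) ^ (l - 1)) ∧
    etaQ ω n (genC (qOf ω) ^ k) =
      (qOf ω ^ (-(k : ℤ)) * (1 - qexp ω (n + k))) • (genC (qOf ω) ^ k * genB (qOf ω)) ∧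
    etaQ ω n (genC (qOf ω) ^ k * genB (qOf ω) ^ l) =
      (qOf ω ^ (-(k : ℤ)) * (1 - qexp ω (n + k))) •
        (genC (qOf ω) ^ k * genB (qOf ω) ^ (l + 1)) ∧
    etaQ ω n (genC (qOf ω) ^ k * genA (qOf ω) ^ l) =
      (qOf ω ^ (-(k : ℤ)) * (1 - qexp ω (n + k)) / (1 - qOf ω)) •
        (genC (qOf ω) ^ k * genA (qOf ω) ^ (l - 1)) -
      (qOf ω ^ (-(k : ℤ)) * (1 - qexp ω (n + k + l)) / (1 - qOf ω)) •
        (genC (qOf ω) ^ (k + 1) * genA (qOf ω) ^ (l - 1)) := by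
  obtain ⟨m, rfl⟩ := Nat.exists_eq_add_of_le' hl
  have hq := qOf_ne_zero ω
  have hq1 := one_sub_qOf_ne_zero hω
  have hAB := genA_mul_genB (qOf ω)
  have hAC := mul_commutator_of_heisenberg hAB
  have hBC := mul_commutator_of_heisenberg' hq hAB
  have hABC := mul_eq_of_heisenberg hq1 hAB
  have hBAC := mul_eq_of_heisenberg' hq1 hAB
  rw [← genC] at hAC hBC hABC hBAC
  have hACk := mul_pow_of_skew_commute hAC k
  have hBCk := mul_pow_of_skew_commute hBC k
  have hAmC := pow_mul_of_skew_commute hAC m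
  have hBmC := pow_mul_of_skew_commute hBC m
  simp only [thetaQ, etaQ, qexp_sub_natCast, qexp_add_natCast, zpow_neg, zpow_natCast,
    Nat.add_sub_cancel]
  generalize qOf ω = q at *
  generalize genC q = C at *
  generalize genA q = A at *
  generalize genB q = B at *
  refine ⟨?_, ?_, ?_, ?_, ?_, ?_⟩
  · rw [hACk]
    match_scalars
    field_simp
  · rw [← mul_assoc, hACk, smul_mul_assoc, mul_assoc, mul_assoc, ← pow_succ, ← pow_succ']
    match_scalars
    field_simp
  · have hl : A * (C ^ k * B ^ (m + 1)) =
        (q ^ k * (1 - q)⁻¹) • (C ^ k * B ^ m - q • (C ^ (k + 1) * B ^ m)) := by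
      rw [← mul_assoc, hACk, smul_mul_assoc, mul_assoc, pow_succ' B, ← mul_assoc A, hABC]
      simp only [smul_mul_assoc, mul_smul_comm, sub_mul, mul_sub, one_mul, smul_smul, pow_succ C,
        mul_assoc]
    have hr : C ^ k * B ^ (m + 1) * A =
        (1 - q)⁻¹ • (C ^ k * B ^ m - q⁻¹ ^ m • (C ^ (k + 1) * B ^ m)) := by
      rw [pow_succ B, mul_assoc, mul_assoc, hBAC]
      simp only [mul_smul_comm, mul_sub, mul_one, hBmC, pow_succ C, mul_assoc]
    rw [hl, hr]
    match_scalars <;> simp <;> field_simp <;> ring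
  · rw [hBCk, inv_pow]
    match_scalars
    field_simp
  · rw [← mul_assoc, hBCk, smul_mul_assoc, mul_assoc, mul_assoc, ← pow_succ, ← pow_succ',
      inv_pow]
    match_scalars
    field_simp
  · have hl : B * (C ^ k * A ^ (m + 1)) =
        (q⁻¹ ^ k * (1 - q)⁻¹) • (C ^ k * A ^ m - C ^ (k + 1) * A ^ m) := by
      rw [← mul_assoc, hBCk, smul_mul_assoc, mul_assoc, pow_succ' A, ← mul_assoc B, hBAC]
      simp only [smul_mul_assoc, mul_smul_comm, sub_mul, mul_sub, one_mul, smul_smul, pow_succ C,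
        mul_assoc]
    have hr : C ^ k * A ^ (m + 1) * B =
        (1 - q)⁻¹ • (C ^ k * A ^ m - q ^ (m + 1) • (C ^ (k + 1) * A ^ m)) := by
      rw [pow_succ A, mul_assoc, mul_assoc, hABC]
      simp only [mul_smul_comm, mul_sub, mul_one, hAmC, pow_succ C, pow_succ q, mul_assoc,
        smul_smul, mul_comm q]
    rw [hl, hr]
    match_scalars <;> simp <;> field_simp <;> ring
end
end

section
/- Let b ≥ 1. For every nonzero element U of H_1 ⊕ H_2 ⊕ ⋯ ⊕ H_b there exists a finite composition θ of maps from Φ_ℤ such that θ(U) is a nonzero element of H_0 = ℂ[C]. -/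
noncomputable section

/-- The deformed commutator map `θ_n : γ ↦ Aγ - q^n γA` on `H(q)`, `n ∈ ℤ`. -/
def thetaZ (q : ℂ) (n : ℤ) (x : HAlg q) : HAlg q :=
  genA q * x - q ^ n • (x * genA q)

/-- The deformed commutator map `η_n : γ ↦ Bγ - q^n γB` on `H(q)`, `n ∈ ℤ`. -/
def etaZ (q : ℂ) (n : ℤ) (x : HAlg q) : HAlg q :=
  genB q * x - q ^ n • (x * genB q)

/-- The graded component `H_i` of `H(q)`: for `i < 0` the span of `{C^k A^(-i) : k ∈ ℕ}`,
for `i > 0` the span of `{C^k B^i : k ∈ ℕ}`, and for `i = 0` the span of `{C^k : k ∈ ℕ}`. -/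
def Hgr (q : ℂ) (i : ℤ) : Submodule ℂ (HAlg q) :=
  Submodule.span ℂ {x | ∃ k : ℕ,
    x = genC q ^ k * (if i < 0 then genA q ^ (-i).toNat else genB q ^ i.toNat)}

/-- The collection `Φ_ℤ = {θ_n : n ∈ ℤ} ∪ {η_n : n ∈ ℤ}` of deformed commutator maps. -/
def PhiZ (q : ℂ) : Set (HAlg q → HAlg q) :=
  {f | ∃ n : ℤ, f = thetaZ q n ∨ f = etaZ q n}

/-- The property of being mapped to a nonzero element of `H_0` by a finite composition of maps
from `Φ_ℤ`. -/
def ReachesHgrZero (q : ℂ) (U : HAlg q) : Prop :=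
  ∃ L : List (HAlg q → HAlg q), (∀ f ∈ L, f ∈ PhiZ q) ∧
    (L.foldr (· ∘ ·) id) U ≠ 0 ∧ (L.foldr (· ∘ ·) id) U ∈ Hgr q 0

theorem ReachesHgrZero.of_apply {q : ℂ} {U : HAlg q} {f : HAlg q → HAlg q} (hf : f ∈ PhiZ q)
    (h : ReachesHgrZero q (f U)) : ReachesHgrZero q U := by
  obtain ⟨L, hL, hne, hmem⟩ := h
  have foldr_comp : ∀ M : List (HAlg q → HAlg q),
      M.foldr (· ∘ ·) f = M.foldr (· ∘ ·) id ∘ f := by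
    intro M
    induction M with
    | nil => rfl
    | cons g M ih => simp only [List.foldr_cons, ih]; rfl
  have key : ((L ++ [f]).foldr (· ∘ ·) id) U = (L.foldr (· ∘ ·) id) (f U) := by
    rw [List.foldr_append]
    exact congrFun (foldr_comp L) U
  refine ⟨L ++ [f], ?_, by rwa [key], by rwa [key]⟩
  intro g hg
  rcases List.mem_append.1 hg with hg | hg
  · exact hL g hg
  · rwa [List.mem_singleton.1 hg]

protected theorem HAlg.sub_smul {q : ℂ} (a b : ℂ) (x : HAlg q) : (a - b) • x = a • x - b • x :=
  sub_smul a b x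

protected theorem HAlg.smul_sub {q : ℂ} (a : ℂ) (x y : HAlg q) : a • (x - y) = a • x - a • y :=
  smul_sub a x y

theorem genC_eq (q : ℂ) : genC q = (q - 1) • (genB q * genA q) + 1 := by
  rw [genC, genA_mul_genB, HAlg.sub_smul, one_smul]
  abel

theorem genA_mul_genC (q : ℂ) : genA q * genC q = q • (genC q * genA q) := by
  have h : genA q * (genB q * genA q) = q • (genB q * genA q * genA q) + genA q := by
    rw [← mul_assoc, genA_mul_genB, add_mul, one_mul, smul_mul_assoc]
  rw [genC_eq, mul_add, mul_smul_comm, h, add_mul, smul_mul_assoc]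
  simp only [mul_one, one_mul]
  module

theorem genC_mul_genB (q : ℂ) : genC q * genB q = q • (genB q * genC q) := by
  have h : genB q * genA q * genB q = q • (genB q * (genB q * genA q)) + genB q := by
    rw [mul_assoc, genA_mul_genB, mul_add, mul_one, mul_smul_comm]
  rw [genC_eq, add_mul, smul_mul_assoc, h, mul_add, mul_smul_comm]
  simp only [mul_one, one_mul]
  module

theorem genA_mul_genC_pow (q : ℂ) (k : ℕ) :
    genA q * genC q ^ k = q ^ k • (genC q ^ k * genA q) := by
  induction k with
  | zero => simp
  | succ k ih =>
    rw [pow_succ, ← mul_assoc, ih, smul_mul_assoc, mul_assoc, genA_mul_genC, mul_smul_comm,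
      smul_smul, pow_succ, mul_assoc]

theorem genB_mul_genC {q : ℂ} (hq0 : q ≠ 0) : genB q * genC q = q⁻¹ • (genC q * genB q) := by
  rw [genC_mul_genB, inv_smul_smul₀ hq0]

theorem genB_mul_genC_pow {q : ℂ} (hq0 : q ≠ 0) (k : ℕ) :
    genB q * genC q ^ k = q⁻¹ ^ k • (genC q ^ k * genB q) := by
  induction k with
  | zero => simp
  | succ k ih =>
    rw [pow_succ, ← mul_assoc, ih, smul_mul_assoc, mul_assoc, genB_mul_genC hq0, mul_smul_comm,
      smul_smul, pow_succ, mul_assoc]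

theorem genB_pow_mul_genC {q : ℂ} (hq0 : q ≠ 0) (l : ℕ) :
    genB q ^ l * genC q = q⁻¹ ^ l • (genC q * genB q ^ l) := by
  induction l with
  | zero => simp
  | succ l ih =>
    rw [pow_succ, mul_assoc, genB_mul_genC hq0, mul_smul_comm, ← mul_assoc, ih, smul_mul_assoc,
      smul_smul, pow_succ, mul_assoc, mul_comm (q⁻¹)]

/-- The commutator of `A` with `B ^ (l + 1)`. -/
theorem genA_mul_genB_pow_sub {q : ℂ} (hq0 : q ≠ 0) (hq : q - 1 ≠ 0) (l : ℕ) :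
    genA q * genB q ^ (l + 1) - genB q ^ (l + 1) * genA q =
      ((q - q⁻¹ ^ l) / (q - 1)) • (genC q * genB q ^ l) := by
  have hBA : genB q * genA q = (q - 1)⁻¹ • (genC q - 1) := by
    rw [genC_eq, add_sub_cancel_right, inv_smul_smul₀ hq]
  have hAB : genA q * genB q = q • (q - 1)⁻¹ • (genC q - 1) + 1 := by
    rw [genA_mul_genB, hBA]
  rw [pow_succ', ← mul_assoc, hAB, ← pow_succ', pow_succ, mul_assoc, hBA, mul_smul_comm, mul_sub,
    genB_pow_mul_genC hq0, add_mul, smul_mul_assoc, smul_mul_assoc, sub_mul, one_mul, mul_one]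
  match_scalars <;> field_simp
  ring

theorem thetaZ_genC_pow (q : ℂ) (k : ℕ) : thetaZ q k (genC q ^ k) = 0 := by
  rw [thetaZ, genA_mul_genC_pow, zpow_natCast, sub_self]

theorem thetaZ_genC_pow_mul_genB_pow {q : ℂ} (hq0 : q ≠ 0) (hq : q - 1 ≠ 0) (k l : ℕ) :
    thetaZ q k (genC q ^ k * genB q ^ (l + 1)) =
      (q ^ k * ((q - q⁻¹ ^ l) / (q - 1))) • (genC q ^ (k + 1) * genB q ^ l) := by
  rw [thetaZ, zpow_natCast, ← mul_assoc, genA_mul_genC_pow, smul_mul_assoc, ← HAlg.smul_sub, mul_assoc,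
    mul_assoc, ← mul_sub, genA_mul_genB_pow_sub hq0 hq, mul_smul_comm, smul_smul, pow_succ,
    mul_assoc]

/-- `θ_n` as a linear map. -/
def thetaLin (q : ℂ) (n : ℤ) : HAlg q →ₗ[ℂ] HAlg q :=
  LinearMap.mulLeft ℂ (genA q) - q ^ n • LinearMap.mulRight ℂ (genA q)

theorem thetaLin_apply (q : ℂ) (n : ℤ) (x : HAlg q) : thetaLin q n x = thetaZ q n x := rfl

/-- `η_n` as a linear map. -/
def etaLin (q : ℂ) (n : ℤ) : HAlg q →ₗ[ℂ] HAlg q :=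
  LinearMap.mulLeft ℂ (genB q) - q ^ n • LinearMap.mulRight ℂ (genB q)

theorem etaLin_apply (q : ℂ) (n : ℤ) (x : HAlg q) : etaLin q n x = etaZ q n x := rfl

theorem etaZ_genC_pow_mul_aeval {q : ℂ} (hq0 : q ≠ 0) (k m : ℕ) (p : Polynomial ℂ) :
    etaZ q (-m) (genC q ^ k * Polynomial.aeval (genB q) p) =
      genC q ^ k * Polynomial.aeval (genB q) ((q⁻¹ ^ k - q⁻¹ ^ m) • (Polynomial.X * p)) := by
  have hcomm : Polynomial.aeval (genB q) p * genB q = genB q * Polynomial.aeval (genB q) p := by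
    have h := congrArg (Polynomial.aeval (genB q)) (mul_comm p Polynomial.X)
    simpa only [map_mul, Polynomial.aeval_X] using h
  rw [etaZ, map_smul, map_mul, Polynomial.aeval_X, ← mul_assoc, genB_mul_genC_pow hq0,
    smul_mul_assoc, mul_assoc, mul_assoc, hcomm, mul_smul_comm, HAlg.sub_smul, zpow_neg, zpow_natCast,
    inv_pow, inv_pow]

/-- The operator of `A` in a representation of `H(q)` on sequences, in which `C` acts
diagonally by `q ^ n`. -/
def seqA : Module.End ℂ (ℕ → ℂ) where
  toFun f n := f (n + 1)
  map_add' _ _ := rfl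
  map_smul' _ _ := rfl

/-- The operator of `B` in the representation of `H(q)` on sequences. -/
def seqB (q : ℂ) : Module.End ℂ (ℕ → ℂ) where
  toFun f n := (∑ i ∈ Finset.range n, q ^ i) * f (n - 1)
  map_add' _ _ := by ext; simp [mul_add]
  map_smul' _ _ := by ext; simp [mul_left_comm]

/-- The representation of `H(q)` on sequences. -/
def seqRep (q : ℂ) : HAlg q →ₐ[ℂ] Module.End ℂ (ℕ → ℂ) :=
  RingQuot.liftAlgHom ℂ ⟨FreeAlgebra.lift ℂ (fun g => HGen.rec seqA (seqB q) g), by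
    rintro _ _ ⟨⟩
    simp only [map_mul, map_add, map_smul, map_one, FreeAlgebra.lift_ι_apply]
    ext f n
    rcases n with _ | n
    · simp [seqA, seqB]
    · simp only [seqA, seqB, Module.End.mul_apply, LinearMap.add_apply, LinearMap.smul_apply,
        Module.End.one_apply, LinearMap.coe_mk, AddHom.coe_mk, Pi.add_apply, Pi.smul_apply,
        smul_eq_mul, Nat.add_sub_cancel]
      rw [Finset.sum_range_succ', add_mul, ← mul_assoc, Finset.mul_sum]
      simp [pow_succ'] ⟩

theorem seqRep_genC_apply_zero (q : ℂ) (f : ℕ → ℂ) : seqRep q (genC q) f 0 = f 0 := by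
  have hA : seqRep q (genA q) = seqA := by
    simp [seqRep, genA]
  have hB : seqRep q (genB q) = seqB q := by
    simp [seqRep, genB]
  rw [genC, map_sub, map_mul, map_mul, hA, hB]
  simp [seqA, seqB]

theorem genC_pow_ne_zero (q : ℂ) (k : ℕ) : genC q ^ k ≠ 0 := by
  have h : ∀ f : ℕ → ℂ, seqRep q (genC q ^ k) f 0 = f 0 := by
    induction k with
    | zero => simp
    | succ k ih =>
      intro f
      rw [pow_succ, map_mul, Module.End.mul_apply, ih, seqRep_genC_apply_zero]
  intro h0
  simpa [h0] using h 1

/-- Repeated application of `θ_k, θ_{k+1}, …` to `∑ c_l C^k B^l` isolates the top term. -/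
theorem reachesHgrZero_sum_range {q : ℂ} (hq0 : q ≠ 0) (hq1 : ∀ m : ℕ, 0 < m → q ^ m ≠ 1)
    (d : ℕ) : ∀ (k : ℕ) (c : ℕ → ℂ), c d ≠ 0 →
      ReachesHgrZero q (∑ l ∈ Finset.range (d + 1), c l • (genC q ^ k * genB q ^ l)) := by
  have hq : q - 1 ≠ 0 := sub_ne_zero.2 (by simpa using hq1 1 one_pos)
  induction d with
  | zero =>
    intro k c hc
    refine ⟨[], by simp, ?_, ?_⟩
    · simpa [hc] using genC_pow_ne_zero q k
    · simp only [zero_add, Finset.range_one, Finset.sum_singleton, pow_zero, List.foldr_nil, id]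
      exact Submodule.smul_mem _ _ (Submodule.subset_span ⟨k, by simp⟩)
  | succ d ih =>
    intro k c hc
    refine ReachesHgrZero.of_apply (f := thetaZ q k) ⟨k, Or.inl rfl⟩ ?_
    have key : thetaZ q k (∑ l ∈ Finset.range (d + 1 + 1), c l • (genC q ^ k * genB q ^ l)) =
        ∑ l ∈ Finset.range (d + 1), (c (l + 1) * (q ^ k * ((q - q⁻¹ ^ l) / (q - 1)))) •
          (genC q ^ (k + 1) * genB q ^ l) := by
      rw [← thetaLin_apply, map_sum, Finset.sum_range_succ']
      simp only [map_smul, thetaLin_apply, thetaZ_genC_pow_mul_genB_pow hq0 hq, pow_zero, mul_one,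
        thetaZ_genC_pow, smul_zero, add_zero, smul_smul]
    rw [key]
    refine ih (k + 1) _ (mul_ne_zero hc (mul_ne_zero (pow_ne_zero _ hq0) (div_ne_zero ?_ hq)))
    intro h
    apply hq1 (d + 1) d.succ_pos
    rw [pow_succ, mul_comm]
    nth_rw 1 [sub_eq_zero.1 h]
    rw [← mul_pow, inv_mul_cancel₀ hq0, one_pow]

theorem reachesHgrZero_genC_pow_mul_aeval {q : ℂ} (hq0 : q ≠ 0)
    (hq1 : ∀ m : ℕ, 0 < m → q ^ m ≠ 1) (k : ℕ) {p : Polynomial ℂ} (hp : p ≠ 0) :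
    ReachesHgrZero q (genC q ^ k * Polynomial.aeval (genB q) p) := by
  have h := reachesHgrZero_sum_range hq0 hq1 p.natDegree k p.coeff
    (Polynomial.leadingCoeff_ne_zero.2 hp)
  simpa only [Polynomial.aeval_eq_sum_range, Finset.mul_sum, mul_smul_comm] using h

theorem inv_pow_ne_inv_pow {q : ℂ} (hq0 : q ≠ 0) (hq1 : ∀ m : ℕ, 0 < m → q ^ m ≠ 1) {k m : ℕ}
    (hkm : k ≠ m) : q⁻¹ ^ k ≠ q⁻¹ ^ m := by
  wlog hlt : k < m generalizing k m
  · exact (this hkm.symm (by omega)).symm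
  intro h
  apply hq1 (m - k) (by omega)
  rw [inv_pow, inv_pow, inv_inj] at h
  rw [pow_sub₀ _ hq0 hlt.le, ← h, mul_inv_cancel₀ (pow_ne_zero _ hq0)]

/-- The maps `η_{-m}` remove all powers of `C` but one. -/
theorem reachesHgrZero_sum_insert {q : ℂ} (hq0 : q ≠ 0) (hq1 : ∀ m : ℕ, 0 < m → q ^ m ≠ 1)
    (k : ℕ) (K : Finset ℕ) : k ∉ K → ∀ p : ℕ → Polynomial ℂ, p k ≠ 0 →
      ReachesHgrZero q (∑ i ∈ insert k K, genC q ^ i * Polynomial.aeval (genB q) (p i)) := by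
  induction K using Finset.induction_on with
  | empty =>
    intro _ p hp
    simpa using reachesHgrZero_genC_pow_mul_aeval hq0 hq1 k hp
  | insert m K hm ih =>
    intro hk p hp
    rw [Finset.mem_insert, not_or] at hk
    refine ReachesHgrZero.of_apply (f := etaZ q (-m)) ⟨-m, Or.inr rfl⟩ ?_
    have hmk : m ∉ insert k K := by
      rw [Finset.mem_insert, not_or]
      exact ⟨Ne.symm hk.1, hm⟩
    rw [Finset.insert_comm, ← etaLin_apply, map_sum, Finset.sum_insert hmk]
    simp only [etaLin_apply, etaZ_genC_pow_mul_aeval hq0]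
    rw [sub_self, zero_smul, map_zero, mul_zero, zero_add]
    exact ih hk.2 (fun i => (q⁻¹ ^ i - q⁻¹ ^ m) • (Polynomial.X * p i)) (smul_ne_zero
      (sub_ne_zero.2 (inv_pow_ne_inv_pow hq0 hq1 hk.1)) (mul_ne_zero Polynomial.X_ne_zero hp))

/-- The linear map `∑ p_k ↦ ∑ C^k p_k(B)`. -/
def normalForm (q : ℂ) : (ℕ →₀ Polynomial ℂ) →ₗ[ℂ] HAlg q :=
  Finsupp.lsum ℂ fun k =>
    LinearMap.mulLeft ℂ (genC q ^ k) ∘ₗ (Polynomial.aeval (genB q)).toLinearMap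

theorem Hgr_le_range_normalForm (q : ℂ) {i : ℤ} (hi : 0 ≤ i) :
    Hgr q i ≤ LinearMap.range (normalForm q) := by
  refine Submodule.span_le.2 ?_
  rintro _ ⟨k, rfl⟩
  refine ⟨Finsupp.single k (Polynomial.X ^ i.toNat), ?_⟩
  simp [normalForm, hi.not_gt]

/-- Let `b ≥ 1`.  For every nonzero `U ∈ H_1 ⊕ H_2 ⊕ ⋯ ⊕ H_b` there is a
finite composition `θ` of maps from `Φ_ℤ` such that `θ(U)` is a nonzero element of
`H_0 = ℂ[C]`. -/
theorem statement_6 (q : ℂ) (hq0 : q ≠ 0) (hq1 : ∀ m : ℕ, 0 < m → q ^ m ≠ 1)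
    (b : ℕ) (hb : 1 ≤ b) (U : HAlg q) (hU : U ≠ 0)
    (hmem : U ∈ ⨆ i ∈ Set.Icc (1 : ℤ) (b : ℤ), Hgr q i) :
    ∃ L : List (HAlg q → HAlg q), (∀ f ∈ L, f ∈ PhiZ q) ∧
      (L.foldr (· ∘ ·) id) U ≠ 0 ∧ (L.foldr (· ∘ ·) id) U ∈ Hgr q 0 := by
  have hle : (⨆ i ∈ Set.Icc (1 : ℤ) (b : ℤ), Hgr q i) ≤ LinearMap.range (normalForm q) :=
    iSup₂_le fun i hi => Hgr_le_range_normalForm q (zero_le_one.trans hi.1)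
  obtain ⟨P, rfl⟩ := hle hmem
  have hP : P ≠ 0 := by
    rintro rfl
    exact hU (map_zero _)
  obtain ⟨k, hk⟩ := Finsupp.support_nonempty_iff.2 hP
  have h := reachesHgrZero_sum_insert hq0 hq1 k (P.support.erase k) (Finset.notMem_erase _ _) P
    (Finsupp.mem_support_iff.1 hk)
  rw [Finset.insert_erase hk] at h
  exact h
end
end
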